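/- Let R₁ = (√3/(2√2))π. Let u be an admissible solution of the vorticity equation on [0,T) with viscosity ν > 0, with ω = ∇×u and ω_h = (ω₁, ω₂, 0). Then for every t ∈ [0,T), the function t ↦ ‖ω(t,·)‖²_{L²(ℝ³)} is differentiable at t with derivative at most −(2/R₁)‖ω(t,·)‖²_{Ḣ¹} (R₁ ν − ‖ω_h(t,·)‖_{Ḣ^{−1/2}}). -/

import Mathlib

open MeasureTheory Real SchwartzMap
open scoped FourierTransform ENNReal

noncomputable section

/-- Euclidean three-space. -/
abbrev E3 : Type := EuclideanSpace ℝ (Fin 3)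

/-- The `i`-th standard basis vector. -/
def ee (i : Fin 3) : E3 := EuclideanSpace.single i 1

/-- The partial derivative `∂ᵢ f`. -/
def pd (i : Fin 3) (f : E3 → ℝ) : E3 → ℝ := fun x => fderiv ℝ f x (ee i)

/-- The Fourier transform (kernel `e^{-2πi x·ξ}`) of a real-valued function. -/
def ft (f : E3 → ℝ) : E3 → ℂ := 𝓕 (fun x => (f x : ℂ))

/-- The squared homogeneous Sobolev norm `‖v‖²_{Ḣ^s}` of a vector field. -/
def hsV (s : ℝ) (v : Fin 3 → E3 → ℝ) : ℝ :=
  ∫ ξ : E3, (2 * π * ‖ξ‖) ^ (2 * s) * ∑ i, ‖ft (v i) ξ‖ ^ 2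

/-- The curl `ω = ∇ × u` of a vector field. -/
def curl (u : Fin 3 → E3 → ℝ) : Fin 3 → E3 → ℝ :=
  ![fun x => pd 1 (u 2) x - pd 2 (u 1) x,
    fun x => pd 2 (u 0) x - pd 0 (u 2) x,
    fun x => pd 0 (u 1) x - pd 1 (u 0) x]

/-- The strain tensor `S = (∇u + (∇u)ᵀ)/2`. -/
def strain (u : Fin 3 → E3 → ℝ) : Fin 3 → Fin 3 → E3 → ℝ :=
  fun i j x => (pd i (u j) x + pd j (u i) x) / 2

/-- The time interval `[0,T)` for `T ∈ (0,∞]`. -/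
def timeSet (T : ℝ≥0∞) : Set ℝ := {t : ℝ | 0 ≤ t ∧ ENNReal.ofReal t < T}

/-- An admissible solution of the vorticity equation on `[0,T)` with viscosity `ν`:
`u` is jointly smooth, Schwartz in space at each time with time-locally uniform
Schwartz seminorm bounds (also for `∂ₜu`), divergence free, and its vorticity
`ω = ∇×u` satisfies `∂ₜω − νΔω + (u·∇)ω − Sω = 0` on `[0,T) × ℝ³`. -/
structure AdmissibleSolution (ν : ℝ) (T : ℝ≥0∞) where
  u : ℝ → Fin 3 → 𝓢(E3, ℝ)
  u' : ℝ → Fin 3 → 𝓢(E3, ℝ)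
  smooth : ∀ i : Fin 3,
    ContDiffOn ℝ (⊤ : ℕ∞) (fun p : ℝ × E3 => u p.1 i p.2) (timeSet T ×ˢ Set.univ)
  tderiv : ∀ t ∈ timeSet T, ∀ i : Fin 3, ∀ x : E3,
    HasDerivWithinAt (fun s => u s i x) (u' t i x) (timeSet T) t
  seminorm_bdd : ∀ K : Set ℝ, IsCompact K → K ⊆ timeSet T → ∀ k n : ℕ, ∀ i : Fin 3,
    ∃ C : ℝ, ∀ t ∈ K, SchwartzMap.seminorm ℝ k n (u t i) ≤ C ∧
      SchwartzMap.seminorm ℝ k n (u' t i) ≤ C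
  divfree : ∀ t ∈ timeSet T, ∀ x : E3, ∑ i, pd i (⇑(u t i)) x = 0
  vort_eq : ∀ t ∈ timeSet T, ∀ x : E3, ∀ k : Fin 3,
    derivWithin (fun s => curl (fun i => ⇑(u s i)) k x) (timeSet T) t
      - ν * (∑ i, pd i (pd i (curl (fun i => ⇑(u t i)) k)) x)
      + (∑ i, u t i x * pd i (curl (fun i => ⇑(u t i)) k) x)
      - (∑ j, strain (fun i => ⇑(u t i)) k j x * curl (fun i => ⇑(u t i)) j x) = 0

/-- The vorticity of an admissible solution at time `t`. -/
def AdmissibleSolution.vort {ν : ℝ} {T : ℝ≥0∞} (sol : AdmissibleSolution ν T)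
    (t : ℝ) : Fin 3 → E3 → ℝ :=
  curl (fun i => ⇑(sol.u t i))

/-- The horizontal part `ω_h = (ω₁, ω₂, 0)` of the vorticity. -/
def AdmissibleSolution.vorth {ν : ℝ} {T : ℝ≥0∞} (sol : AdmissibleSolution ν T)
    (t : ℝ) : Fin 3 → E3 → ℝ :=
  ![sol.vort t 0, sol.vort t 1, fun _ => 0]

/-- The enstrophy `E(t) = (1/2)‖ω(t,·)‖²_{L²}`. -/
def AdmissibleSolution.enstrophy {ν : ℝ} {T : ℝ≥0∞} (sol : AdmissibleSolution ν T)
    (t : ℝ) : ℝ :=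
  (1 / 2) * ∫ x : E3, ∑ k, (sol.vort t k x) ^ 2

/-- The constant `R₁ = (√3/(2√2))π`. -/
def R₁ : ℝ := (Real.sqrt 3 / (2 * Real.sqrt 2)) * π


open scoped LineDeriv


lemma feynman (A B : ℝ) (hA : 0 < A) (hB : 0 < B) :
    ENNReal.ofReal (1 / (A * B)) =
      ∫⁻ θ in Set.Ioo (0:ℝ) 1, ENNReal.ofReal (1 / (θ * A + (1 - θ) * B) ^ 2) := by
  have hpos : ∀ θ ∈ Set.Icc (0:ℝ) 1, 0 < θ * A + (1 - θ) * B := by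
    intro θ ⟨h0, h1⟩
    rcases eq_or_lt_of_le h0 with h | h
    · subst h; simpa using hB
    · have := mul_pos h hA
      have : 0 ≤ (1 - θ) * B := mul_nonneg (by linarith) hB.le
      linarith
  have hcont : ContinuousOn (fun θ : ℝ => 1 / (θ * A + (1 - θ) * B) ^ 2) (Set.Icc 0 1) := by
    apply ContinuousOn.div continuousOn_const (by fun_prop)
    intro θ hθ
    exact (pow_pos (hpos θ hθ) 2).ne'
  have hInt0 : IntegrableOn (fun θ : ℝ => 1 / (θ * A + (1 - θ) * B) ^ 2) (Set.Ioo 0 1) :=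
    (hcont.integrableOn_Icc).mono_set Set.Ioo_subset_Icc_self
  rw [← ofReal_integral_eq_lintegral_ofReal hInt0
    (Filter.Eventually.of_forall fun θ => by positivity)]
  congr 1
  rw [← integral_Ioc_eq_integral_Ioo, ← intervalIntegral.integral_of_le zero_le_one]
  rw [intervalIntegral.integral_eq_sub_of_hasDerivAt
    (f := fun θ => θ / (B * (θ * A + (1 - θ) * B)))]
  · simp; field_simp
  · intro θ hθ
    rw [Set.uIcc_of_le zero_le_one] at hθ
    have h := hpos θ hθ
    have h1 : HasDerivAt (fun θ : ℝ => B * (θ * A + (1 - θ) * B)) (B * (A - B)) θ := by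
      have : HasDerivAt (fun θ : ℝ => θ * A + (1 - θ) * B) (1 * A + (0 - 1) * B) θ :=
        ((hasDerivAt_id θ).mul_const A).add (((hasDerivAt_const θ 1).sub (hasDerivAt_id θ)).mul_const B)
      exact (this.const_mul B).congr_deriv (by ring)
    refine ((hasDerivAt_id θ).div h1 (by positivity)).congr_deriv ?_
    simp only [id]
    field_simp
    ring
  · apply ContinuousOn.intervalIntegrable
    rwa [Set.uIcc_of_le zero_le_one]

lemma radial1 (m : ℝ) (hm : 0 < m) :
    IntegrableOn (fun r : ℝ => r ^ 2 * (1 / (r ^ 2 + m ^ 2) ^ 2)) (Set.Ioi 0) ∧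
    ∫ r in Set.Ioi (0:ℝ), r ^ 2 * (1 / (r ^ 2 + m ^ 2) ^ 2) = π / (4 * m) := by
  set F : ℝ → ℝ := fun r => (arctan (r / m) / m - r / (r ^ 2 + m ^ 2)) / 2 with hF
  have hd : ∀ r : ℝ, HasDerivAt F (r ^ 2 * (1 / (r ^ 2 + m ^ 2) ^ 2)) r := by
    intro r
    have hp : 0 < r ^ 2 + m ^ 2 := by positivity
    have h1 : HasDerivAt (fun r : ℝ => arctan (r / m)) (1 / (1 + (r / m) ^ 2) * (1 / m)) r :=
      ((hasDerivAt_id r).div_const m).arctan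
    have h2 : HasDerivAt (fun r : ℝ => r ^ 2 + m ^ 2) (2 * r) r := by
      simpa using (hasDerivAt_pow 2 r).add_const (m ^ 2)
    have h3 := (hasDerivAt_id r).div h2 hp.ne'
    refine (((h1.div_const m).sub h3).div_const 2).congr_deriv ?_
    simp only [id]
    have : 1 + (r / m) ^ 2 = (r ^ 2 + m ^ 2) / m ^ 2 := by field_simp; ring
    rw [this]
    field_simp
    ring
  have ht : Filter.Tendsto F Filter.atTop (nhds (π / (4 * m))) := by
    have h1 : Filter.Tendsto (fun r : ℝ => arctan (r / m)) Filter.atTop (nhds (π / 2)) :=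
      (tendsto_nhds_of_tendsto_nhdsWithin tendsto_arctan_atTop).comp
        (Filter.tendsto_id.atTop_div_const hm)
    have h2 : Filter.Tendsto (fun r : ℝ => r / (r ^ 2 + m ^ 2)) Filter.atTop (nhds 0) := by
      apply squeeze_zero' (g := fun r : ℝ => r⁻¹)
      · filter_upwards [Filter.eventually_gt_atTop 0] with r hr
        positivity
      · filter_upwards [Filter.eventually_gt_atTop 0] with r hr
        rw [div_le_iff₀ (by positivity)]
        have : r⁻¹ * (r ^ 2 + m ^ 2) = r + r⁻¹ * m ^ 2 := by field_simp
        rw [this]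
        have : 0 ≤ r⁻¹ * m ^ 2 := by positivity
        linarith
      · exact tendsto_inv_atTop_zero
    have := ((h1.div_const m).sub h2).div_const 2
    convert this using 2
    field_simp
    ring
  have hc : ContinuousWithinAt F (Set.Ici 0) 0 := (hd 0).continuousAt.continuousWithinAt
  constructor
  · exact integrableOn_Ioi_deriv_of_nonneg hc (fun x _ => hd x) (fun x _ => by positivity) ht
  · rw [integral_Ioi_of_hasDerivAt_of_nonneg hc (fun x _ => hd x) (fun x _ => by positivity) ht]
    simp [hF]

lemma radial3 (m : ℝ) (hm : 0 < m) :
    ∫⁻ η : E3, ENNReal.ofReal (1 / (‖η‖ ^ 2 + m ^ 2) ^ 2) = ENNReal.ofReal (π ^ 2 / m) := by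
  have hfr : Module.finrank ℝ E3 = 3 := by simp
  have hi : Integrable (fun η : E3 => 1 / (‖η‖ ^ 2 + m ^ 2) ^ 2) := by
    rw [integrable_fun_norm_addHaar (μ := (volume : Measure E3))
      (f := fun r => 1 / (r ^ 2 + m ^ 2) ^ 2)]
    rw [hfr]
    simpa using (radial1 m hm).1
  rw [← ofReal_integral_eq_lintegral_ofReal hi
    (Filter.Eventually.of_forall fun θ => by positivity)]
  congr 1
  rw [integral_fun_norm_addHaar (μ := (volume : Measure E3))
      (f := fun r => 1 / (r ^ 2 + m ^ 2) ^ 2), hfr]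
  have := (radial1 m hm).2
  simp only [Nat.add_one_sub_one, smul_eq_mul, nsmul_eq_mul] at this ⊢
  rw [this]
  have hv : (volume : Measure E3).real (Metric.ball 0 1) = π * 4 / 3 := by
    rw [Measure.real, EuclideanSpace.volume_ball_fin_three]
    simp; positivity
  rw [hv]
  push_cast
  field_simp

lemma arcs : ∫⁻ θ in Set.Ioo (0:ℝ) 1, ENNReal.ofReal (1 / √(θ * (1 - θ))) ≤ ENNReal.ofReal π := by
  set F : ℝ → ℝ := fun θ => arcsin (2 * θ - 1) with hF
  have hd : ∀ θ ∈ Set.Ioo (0:ℝ) 1, HasDerivAt F (1 / √(θ * (1 - θ))) θ := by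
    intro θ ⟨h0, h1⟩
    have h2 : HasDerivAt (fun θ : ℝ => 2 * θ - 1) 2 θ := by
      simpa using ((hasDerivAt_id θ).const_mul 2).sub_const 1
    have h3 := (hasDerivAt_arcsin (x := 2 * θ - 1) (by linarith) (by linarith)).comp θ h2
    refine h3.congr_deriv ?_
    have : 1 - (2 * θ - 1) ^ 2 = 2 ^ 2 * (θ * (1 - θ)) := by ring
    rw [this, Real.sqrt_mul (by positivity), Real.sqrt_sq (by norm_num)]
    field_simp
  have hc : ContinuousOn F (Set.Icc 0 1) := by
    apply Continuous.continuousOn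
    exact continuous_arcsin.comp (by fun_prop)
  have hInt0 : IntervalIntegrable (fun θ : ℝ => 1 / √(θ * (1 - θ))) volume 0 1 := by
    rw [intervalIntegrable_iff_integrableOn_Ioc_of_le zero_le_one]
    exact intervalIntegral.integrableOn_deriv_of_nonneg hc hd (fun x _ => by positivity)
  have hio : IntegrableOn (fun θ : ℝ => 1 / √(θ * (1 - θ))) (Set.Ioo 0 1) := by
    rw [← integrableOn_Ioc_iff_integrableOn_Ioo]
    rwa [intervalIntegrable_iff_integrableOn_Ioc_of_le zero_le_one] at hInt0
  rw [← ofReal_integral_eq_lintegral_ofReal hio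
    (Filter.Eventually.of_forall fun θ => by positivity)]
  apply le_of_eq
  congr 1
  rw [← integral_Ioc_eq_integral_Ioo, ← intervalIntegral.integral_of_le zero_le_one]
  rw [intervalIntegral.integral_eq_sub_of_hasDerivAt_of_le zero_le_one hc hd hInt0]
  simp only [hF]
  norm_num


lemma kernel (ξ : E3) (hξ : ξ ≠ 0) :
    ∫⁻ η : E3, ENNReal.ofReal (1 / (‖ξ - η‖ ^ 2 * ‖η‖ ^ 2)) ≤ ENNReal.ofReal (π ^ 3 / ‖ξ‖) := by
  have hξ' : 0 < ‖ξ‖ := norm_pos_iff.mpr hξ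
  calc ∫⁻ η : E3, ENNReal.ofReal (1 / (‖ξ - η‖ ^ 2 * ‖η‖ ^ 2))
      = ∫⁻ η : E3, ∫⁻ θ in Set.Ioo (0:ℝ) 1,
          ENNReal.ofReal (1 / (θ * ‖ξ - η‖ ^ 2 + (1 - θ) * ‖η‖ ^ 2) ^ 2) := by
        apply lintegral_congr_ae
        have h0 : ∀ᵐ η : E3, η ≠ 0 := by
          simp [ae_iff]
        have h1 : ∀ᵐ η : E3, η ≠ ξ := by
          simp [ae_iff]
        filter_upwards [h0, h1] with η h0 h1
        exact feynman _ _ (pow_pos (norm_pos_iff.mpr (sub_ne_zero.mpr h1.symm)) 2)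
          (pow_pos (norm_pos_iff.mpr h0) 2)
    _ = ∫⁻ θ in Set.Ioo (0:ℝ) 1, ∫⁻ η : E3,
          ENNReal.ofReal (1 / (θ * ‖ξ - η‖ ^ 2 + (1 - θ) * ‖η‖ ^ 2) ^ 2) := by
        apply lintegral_lintegral_swap
        apply Measurable.aemeasurable
        apply Measurable.ennreal_ofReal
        apply Measurable.div measurable_const
        fun_prop
    _ = ∫⁻ θ in Set.Ioo (0:ℝ) 1, ENNReal.ofReal (π ^ 2 / ‖ξ‖) *
          ENNReal.ofReal (1 / √(θ * (1 - θ))) := by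
        apply setLIntegral_congr_fun measurableSet_Ioo
        intro θ ⟨h0, h1⟩
        have hs : 0 < θ * (1 - θ) := mul_pos h0 (by linarith)
        have key : ∀ η : E3, θ * ‖ξ - η‖ ^ 2 + (1 - θ) * ‖η‖ ^ 2
            = ‖η - θ • ξ‖ ^ 2 + (√(θ * (1 - θ)) * ‖ξ‖) ^ 2 := by
          intro η
          rw [mul_pow, Real.sq_sqrt hs.le, norm_sub_sq_real, norm_sub_sq_real, norm_smul,
            inner_smul_right, real_inner_comm, Real.norm_of_nonneg h0.le]
          ring
        simp only [key]
        rw [lintegral_sub_right_eq_self (μ := (volume : Measure E3)) (fun η : E3 => ENNReal.ofReal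
          (1 / (‖η‖ ^ 2 + (√(θ * (1 - θ)) * ‖ξ‖) ^ 2) ^ 2)) (θ • ξ)]
        rw [radial3 _ (mul_pos (Real.sqrt_pos.mpr hs) hξ'), ← ENNReal.ofReal_mul (by positivity)]
        congr 1
        field_simp
    _ ≤ ENNReal.ofReal (π ^ 2 / ‖ξ‖) * ENNReal.ofReal π := by
        rw [lintegral_const_mul' _ _ ENNReal.ofReal_ne_top]
        gcongr
        exact arcs
    _ = ENNReal.ofReal (π ^ 3 / ‖ξ‖) := by
        rw [← ENNReal.ofReal_mul (by positivity)]
        congr 1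
        field_simp


lemma trilin_b (F : E3 → ℝ) (hF : Measurable F)
    (hX : Integrable (fun ξ : E3 => (2 * π * ‖ξ‖)⁻¹ * F ξ ^ 2)) :
    ∫⁻ p : E3 × E3, ENNReal.ofReal (F (-(p.1 + p.2)) ^ 2 / (‖p.1‖ ^ 2 * ‖p.2‖ ^ 2)) ≤
      ENNReal.ofReal (2 * π ^ 4 * ∫ ξ : E3, (2 * π * ‖ξ‖)⁻¹ * F ξ ^ 2) := by
  rw [Measure.volume_eq_prod, lintegral_prod _ (Measurable.aemeasurable (by fun_prop))]
  calc ∫⁻ x : E3, ∫⁻ y : E3, ENNReal.ofReal (F (-(x + y)) ^ 2 / (‖x‖ ^ 2 * ‖y‖ ^ 2))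
      = ∫⁻ x : E3, ∫⁻ ξ : E3, ENNReal.ofReal (F ξ ^ 2 / (‖x‖ ^ 2 * ‖-ξ - x‖ ^ 2)) := by
        apply lintegral_congr
        intro x
        have h1 := lintegral_sub_left_eq_self (μ := (volume : Measure E3))
          (fun ξ : E3 => ENNReal.ofReal (F ξ ^ 2 / (‖x‖ ^ 2 * ‖-ξ - x‖ ^ 2))) (-x)
        rw [← h1]
        apply lintegral_congr
        intro y
        have e1 : -x - y = -(x + y) := by abel
        have e2 : -(-(x + y)) - x = y := by abel
        rw [e1, e2]
    _ = ∫⁻ ξ : E3, ∫⁻ x : E3, ENNReal.ofReal (F ξ ^ 2 / (‖x‖ ^ 2 * ‖-ξ - x‖ ^ 2)) := by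
        apply lintegral_lintegral_swap
        apply Measurable.aemeasurable
        fun_prop
    _ ≤ ∫⁻ ξ : E3, ENNReal.ofReal (2 * π ^ 4 * ((2 * π * ‖ξ‖)⁻¹ * F ξ ^ 2)) := by
        apply lintegral_mono_ae
        have h0 : ∀ᵐ η : E3, η ≠ 0 := by
          simp [ae_iff]
        filter_upwards [h0] with ξ h0
        have e : ∀ x : E3, ENNReal.ofReal (F ξ ^ 2 / (‖x‖ ^ 2 * ‖-ξ - x‖ ^ 2)) =
            ENNReal.ofReal (F ξ ^ 2) * ENNReal.ofReal (1 / (‖-ξ - x‖ ^ 2 * ‖x‖ ^ 2)) := by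
          intro x
          rw [← ENNReal.ofReal_mul (by positivity)]
          congr 1
          rw [mul_one_div, mul_comm (‖x‖ ^ 2)]
        simp only [e]
        rw [lintegral_const_mul' _ _ ENNReal.ofReal_ne_top]
        refine (mul_le_mul_right (kernel (-ξ) (neg_ne_zero.mpr h0)) _).trans (le_of_eq ?_)
        rw [← ENNReal.ofReal_mul (by positivity), norm_neg]
        congr 1
        have : ‖ξ‖ ≠ 0 := norm_ne_zero_iff.mpr h0
        field_simp
    _ = _ := by
        rw [← integral_const_mul, ofReal_integral_eq_lintegral_ofReal (hX.const_mul _)]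
        exact Filter.Eventually.of_forall fun ξ => by positivity

lemma trilin (F G : E3 → ℝ) (hF : Measurable F) (hG : Measurable G) (hF0 : ∀ x, 0 ≤ F x)
    (hG0 : ∀ x, 0 ≤ G x)
    (hX : Integrable (fun ξ : E3 => (2 * π * ‖ξ‖)⁻¹ * F ξ ^ 2))
    (hY : Integrable (fun ξ : E3 => (2 * π * ‖ξ‖) ^ 2 * G ξ ^ 2)) :
    ∫⁻ p : E3 × E3, ENNReal.ofReal (F (-(p.1 + p.2)) * (G p.1 * G p.2)) ≤
      ENNReal.ofReal ((√2 / 4) * √(∫ ξ : E3, (2 * π * ‖ξ‖)⁻¹ * F ξ ^ 2) *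
        ∫ ξ : E3, (2 * π * ‖ξ‖) ^ 2 * G ξ ^ 2) := by
  set X := ∫ ξ : E3, (2 * π * ‖ξ‖)⁻¹ * F ξ ^ 2 with hXd
  set Y := ∫ ξ : E3, (2 * π * ‖ξ‖) ^ 2 * G ξ ^ 2 with hYd
  have hX0 : 0 ≤ X := integral_nonneg fun ξ => by positivity
  have hY0 : 0 ≤ Y := integral_nonneg fun ξ => by positivity
  let a : E3 × E3 → ℝ≥0∞ := fun p => ENNReal.ofReal ((‖p.1‖ * G p.1) * (‖p.2‖ * G p.2))
  let b : E3 × E3 → ℝ≥0∞ := fun p => ENNReal.ofReal (F (-(p.1 + p.2)) / (‖p.1‖ * ‖p.2‖))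
  have ha : Measurable a := by fun_prop
  have hb : Measurable b := by fun_prop
  have hab : ∫⁻ p : E3 × E3, ENNReal.ofReal (F (-(p.1 + p.2)) * (G p.1 * G p.2)) =
      ∫⁻ p, (a * b) p := by
    apply lintegral_congr_ae
    have h0 : ∀ᵐ η : E3, η ≠ 0 := by
      simp [ae_iff]
    have h1 : ∀ᵐ p : E3 × E3, p.1 ≠ 0 := Measure.quasiMeasurePreserving_fst.ae h0
    have h2 : ∀ᵐ p : E3 × E3, p.2 ≠ 0 := Measure.quasiMeasurePreserving_snd.ae h0
    filter_upwards [h1, h2] with p h1 h2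
    have h1' := norm_ne_zero_iff.mpr h1
    have h2' := norm_ne_zero_iff.mpr h2
    have := hG0 p.1
    have := hG0 p.2
    simp only [a, b, Pi.mul_apply]
    rw [← ENNReal.ofReal_mul (by positivity)]
    congr 1
    field_simp
  have hA : ∫⁻ p, a p ^ (2:ℝ) = ENNReal.ofReal (Y / (4 * π ^ 2)) ^ 2 := by
    have e1 : ∀ p, a p ^ (2:ℝ) =
        ENNReal.ofReal ((‖p.1‖ * G p.1) ^ 2) * ENNReal.ofReal ((‖p.2‖ * G p.2) ^ 2) := by
      intro p
      have := hG0 p.1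
      have := hG0 p.2
      simp only [a]
      rw [← ENNReal.ofReal_mul (by positivity), ENNReal.rpow_two,
        ← ENNReal.ofReal_pow (by positivity), mul_pow]
    simp only [e1]
    rw [Measure.volume_eq_prod, lintegral_prod_mul (f := fun x : E3 => ENNReal.ofReal ((‖x‖ * G x) ^ 2))
      (g := fun x : E3 => ENNReal.ofReal ((‖x‖ * G x) ^ 2))
      (Measurable.aemeasurable (by fun_prop)) (Measurable.aemeasurable (by fun_prop)), ← sq]
    congr 1
    have e2 : ∀ x : E3, (‖x‖ * G x) ^ 2 = ((2 * π * ‖x‖) ^ 2 * G x ^ 2) / (4 * π ^ 2) := by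
      intro x; field_simp; ring
    simp only [e2]
    rw [← ofReal_integral_eq_lintegral_ofReal (hY.div_const _)
      (Filter.Eventually.of_forall fun ξ => by positivity), integral_div]
  have hB : ∫⁻ p, b p ^ (2:ℝ) ≤ ENNReal.ofReal (2 * π ^ 4 * X) := by
    refine le_trans (le_of_eq ?_) (trilin_b F hF hX)
    apply lintegral_congr
    intro p
    have := hF0 (-(p.1 + p.2))
    simp only [b]
    rw [ENNReal.rpow_two, ← ENNReal.ofReal_pow (by positivity), div_pow, mul_pow]
  rw [hab]
  refine (ENNReal.lintegral_mul_le_Lp_mul_Lq volume Real.HolderConjugate.two_two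
    ha.aemeasurable hb.aemeasurable).trans ?_
  rw [hA]
  refine (mul_le_mul_right (ENNReal.rpow_le_rpow hB (by norm_num)) _).trans (le_of_eq ?_)
  have e1 : (ENNReal.ofReal (Y / (4 * π ^ 2)) ^ 2) ^ ((1:ℝ) / 2) = ENNReal.ofReal (Y / (4 * π ^ 2)) := by
    rw [← ENNReal.rpow_two, ← ENNReal.rpow_mul]
    norm_num
  have e2 : ENNReal.ofReal (2 * π ^ 4 * X) ^ ((1:ℝ) / 2) = ENNReal.ofReal (√2 * √(π ^ 4) * √X) := by
    rw [ENNReal.ofReal_rpow_of_nonneg (by positivity) (by norm_num), ← Real.sqrt_eq_rpow,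
      Real.sqrt_mul (by positivity), Real.sqrt_mul (by positivity)]
  rw [e1, e2]
  rw [← ENNReal.ofReal_mul (by positivity)]
  congr 1
  have : √(π ^ 4) = π ^ 2 := by
    rw [show π ^ 4 = (π ^ 2) ^ 2 by ring, Real.sqrt_sq (by positivity)]
  rw [this]
  field_simp


/-- complexification of a real Schwartz function -/
def cx (f : 𝓢(E3, ℝ)) : 𝓢(E3, ℂ) := SchwartzMap.postcompCLM (𝕜 := ℝ) Complex.ofRealCLM f

lemma cx_apply (f : 𝓢(E3, ℝ)) (x : E3) : cx f x = (f x : ℂ) := rfl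

/-- Fourier transform of a real Schwartz function -/
def FT (f : 𝓢(E3, ℝ)) : 𝓢(E3, ℂ) := 𝓕 (cx f)

lemma ft_eq (f : 𝓢(E3, ℝ)) : ft ⇑f = ⇑(FT f) := by
  rw [FT, SchwartzMap.fourier_coe]; rfl

/-- partial derivative of a Schwartz function -/
def dS (i : Fin 3) (f : 𝓢(E3, ℝ)) : 𝓢(E3, ℝ) := ∂_{ee i} f

lemma pd_eq (i : Fin 3) (f : 𝓢(E3, ℝ)) : pd i ⇑f = ⇑(dS i f) := by
  ext x
  rw [dS, SchwartzMap.lineDerivOp_apply_eq_fderiv]; rfl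

lemma inner_ee (ξ : E3) (i : Fin 3) : inner ℝ ξ (ee i) = ξ i := by
  simp [ee, EuclideanSpace.inner_single_right]

lemma FT_sub (f g : 𝓢(E3, ℝ)) : FT (f - g) = FT f - FT g := by
  have : cx (f - g) = cx f - cx g := by simp [cx]
  rw [FT, this, FT, FT]
  exact (SchwartzMap.fourierTransformCLM ℂ).map_sub _ _

lemma FT_add (f g : 𝓢(E3, ℝ)) : FT (f + g) = FT f + FT g := by
  have : cx (f + g) = cx f + cx g := by simp [cx]
  rw [FT, this, FT, FT]
  exact (SchwartzMap.fourierTransformCLM ℂ).map_add _ _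

lemma FT_smul (c : ℝ) (f : 𝓢(E3, ℝ)) (ξ : E3) : FT (c • f) ξ = c * FT f ξ := by
  have : cx (c • f) = (c : ℂ) • cx f := by ext x; simp [cx_apply]
  rw [FT, this, FT]
  have := (SchwartzMap.fourierTransformCLM (V := E3) (E := ℂ) ℂ).map_smul (c:ℂ) (cx f)
  have h2 := congrArg (fun g : 𝓢(E3, ℂ) => g ξ) this
  simp

lemma FT_dS (i : Fin 3) (f : 𝓢(E3, ℝ)) (ξ : E3) :
    FT (dS i f) ξ = (ξ i : ℂ) * (2 * π * Complex.I * FT f ξ) := by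
  have h : cx (dS i f) = ∂_{ee i} (cx f) := by
    ext x
    rw [SchwartzMap.lineDerivOp_apply_eq_fderiv, cx_apply, dS,
      SchwartzMap.lineDerivOp_apply_eq_fderiv]
    have : HasFDerivAt (fun x => ((f x : ℝ) : ℂ)) (Complex.ofRealCLM.comp (fderiv ℝ f x)) x :=
      Complex.ofRealCLM.hasFDerivAt.comp x (f.differentiableAt.hasFDerivAt)
    have h2 : fderiv ℝ (⇑(cx f)) x = _ := this.fderiv
    rw [h2]; rfl
  rw [FT, h, SchwartzMap.fourier_lineDerivOp_eq]
  simp only [smul_apply]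
  rw [SchwartzMap.smulLeftCLM_apply_apply (by fun_prop), inner_ee, ← FT]
  simp
  ring

lemma inv_formula (g : 𝓢(E3, ℝ)) (x : E3) :
    ((g x : ℝ) : ℂ) = ∫ η : E3, (𝐞 (inner ℝ η x) : ℂ) * FT g η := by
  have h : 𝓕⁻ (FT g) = cx g := by simp [FT]
  have h2 := congrArg (fun g : 𝓢(E3, ℂ) => g x) h
  simp only [SchwartzMap.fourierInv_coe, cx_apply] at h2
  rw [← h2, Real.fourierInv_eq]
  rfl

lemma tri_integrable (f g h : 𝓢(E3, ℝ)) :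
    Integrable (fun p : E3 × E3 => FT f (-(p.1 + p.2)) * (FT g p.1 * FT h p.2)) := by
  have h1 : Integrable (fun p : E3 × E3 => FT g p.1 * FT h p.2) :=
    (FT g).integrable.mul_prod (FT h).integrable
  refine h1.bdd_mul (c := SchwartzMap.seminorm ℂ 0 0 (FT f)) ?_ ?_
  · apply Continuous.aestronglyMeasurable
    exact (FT f).continuous.comp (by fun_prop)
  · exact Filter.Eventually.of_forall fun p => SchwartzMap.norm_le_seminorm ℂ _ _

lemma tri_identity (f g h : 𝓢(E3, ℝ)) :
    ((∫ x : E3, f x * (g x * h x) : ℝ) : ℂ) =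
      ∫ p : E3 × E3, FT f (-(p.1 + p.2)) * (FT g p.1 * FT h p.2) := by
  have hInt0 : Integrable (fun p : E3 × E3 => FT g p.1 * FT h p.2) :=
    (FT g).integrable.mul_prod (FT h).integrable
  have e1 : ∀ x : E3, ((f x * (g x * h x) : ℝ) : ℂ) =
      ∫ p : E3 × E3, (𝐞 (inner ℝ (p.1 + p.2) x) : ℂ) * ((f x : ℂ) * (FT g p.1 * FT h p.2)) := by
    intro x
    push_cast
    rw [inv_formula g x, inv_formula h x, Measure.volume_eq_prod, ← integral_prod_mul,
      ← integral_const_mul]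
    congr 1
    ext p
    rw [inner_add_left, AddChar.map_add_eq_mul]
    push_cast
    ring
  rw [← integral_complex_ofReal]
  simp only [e1]
  rw [integral_integral_swap]
  · apply integral_congr_ae
    refine Filter.Eventually.of_forall fun p => ?_
    beta_reduce
    have e2 : FT f (-(p.1 + p.2)) = ∫ x : E3, 𝐞 (-inner ℝ x (-(p.1 + p.2))) • cx f x := by
      rw [FT, SchwartzMap.fourier_coe, Real.fourier_eq]
    rw [e2, ← integral_mul_const]
    apply integral_congr_ae
    refine Filter.Eventually.of_forall fun x => ?_
    beta_reduce
    rw [inner_neg_right, neg_neg, real_inner_comm, cx_apply, Circle.smul_def, smul_eq_mul]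
    ring
  · have h0 : Integrable (fun q : E3 × (E3 × E3) => (f q.1 : ℂ) * (FT g q.2.1 * FT h q.2.2))
        (volume.prod volume) := (cx f).integrable.mul_prod hInt0
    refine h0.bdd_mul (c := 1) ?_ ?_
    · apply Continuous.aestronglyMeasurable
      have : Continuous fun r : ℝ => ((𝐞 r : Circle) : ℂ) :=
        continuous_induced_dom.comp Real.continuous_fourierChar
      exact this.comp (by fun_prop : Continuous fun q : E3 × (E3 × E3) => (inner ℝ (q.2.1 + q.2.2) q.1 : ℝ))
    · exact Filter.Eventually.of_forall fun p => (Circle.norm_coe _).le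



lemma alg_real (x0 x1 x2 a0 a1 a2 : ℝ) (h : x0 * a0 + x1 * a1 + x2 * a2 = 0) :
    (x2 * a2) ^ 2 ≤ ((x1 * a2 - x2 * a1) ^ 2 + (x2 * a0 - x0 * a2) ^ 2) / 2 ∧
    (x0 * a2 + x2 * a0) ^ 2 + (x1 * a2 + x2 * a1) ^ 2 ≤
      (x1 * a2 - x2 * a1) ^ 2 + (x2 * a0 - x0 * a2) ^ 2 ∧
    (x0 * a0) ^ 2 + ((x0 * a1 + x1 * a0) / 2) ^ 2 + ((x1 * a0 + x0 * a1) / 2) ^ 2 + (x1 * a1) ^ 2 ≤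
      ((x1 * a2 - x2 * a1) ^ 2 + (x2 * a0 - x0 * a2) ^ 2 + (x0 * a1 - x1 * a0) ^ 2) / 2 := by
  have h1 : x2 * a2 = -(x0 * a0 + x1 * a1) := by linarith
  have e : (x1 * a2 - x2 * a1) ^ 2 + (x2 * a0 - x0 * a2) ^ 2 =
      (x0 ^ 2 + x1 ^ 2) * a2 ^ 2 + x2 ^ 2 * (a0 ^ 2 + a1 ^ 2) + 2 * (x2 * a2) ^ 2 := by
    linear_combination (-2 * x2 * a2) * h
  have e2 : (x0 * a2 + x2 * a0) ^ 2 + (x1 * a2 + x2 * a1) ^ 2 =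
      (x0 ^ 2 + x1 ^ 2) * a2 ^ 2 + x2 ^ 2 * (a0 ^ 2 + a1 ^ 2) - 2 * (x2 * a2) ^ 2 := by
    linear_combination (2 * x2 * a2) * h
  have p1 : 0 ≤ (x0 ^ 2 + x1 ^ 2) * a2 ^ 2 := by positivity
  have p2 : 0 ≤ x2 ^ 2 * (a0 ^ 2 + a1 ^ 2) := by positivity
  have p3 : 0 ≤ (x2 * a2) ^ 2 := by positivity
  refine ⟨by rw [e]; linarith, by rw [e, e2]; linarith, ?_⟩
  have p4 : (x2 * a2) ^ 2 = (x0 * a0 + x1 * a1) ^ 2 := by rw [h1]; ring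
  rw [e]
  nlinarith

lemma alg_cx (x0 x1 x2 : ℝ) (a0 a1 a2 : ℂ) (h : (x0:ℂ) * a0 + x1 * a1 + x2 * a2 = 0) :
    ‖(x2:ℂ) * a2‖ ^ 2 ≤ (‖(x1:ℂ) * a2 - x2 * a1‖ ^ 2 + ‖(x2:ℂ) * a0 - x0 * a2‖ ^ 2) / 2 ∧
    ‖(x0:ℂ) * a2 + x2 * a0‖ ^ 2 + ‖(x1:ℂ) * a2 + x2 * a1‖ ^ 2 ≤
      ‖(x1:ℂ) * a2 - x2 * a1‖ ^ 2 + ‖(x2:ℂ) * a0 - x0 * a2‖ ^ 2 ∧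
    ‖(x0:ℂ) * a0‖ ^ 2 + ‖((x0:ℂ) * a1 + x1 * a0) / 2‖ ^ 2 + ‖((x1:ℂ) * a0 + x0 * a1) / 2‖ ^ 2
        + ‖(x1:ℂ) * a1‖ ^ 2 ≤
      (‖(x1:ℂ) * a2 - x2 * a1‖ ^ 2 + ‖(x2:ℂ) * a0 - x0 * a2‖ ^ 2
        + ‖(x0:ℂ) * a1 - x1 * a0‖ ^ 2) / 2 := by
  have hr := congrArg Complex.re h
  have hi := congrArg Complex.im h
  simp at hr hi
  obtain ⟨r1, r2, r3⟩ := alg_real x0 x1 x2 a0.re a1.re a2.re hr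
  obtain ⟨i1, i2, i3⟩ := alg_real x0 x1 x2 a0.im a1.im a2.im hi
  have d2 : ∀ z : ℂ, ‖z / 2‖ ^ 2 = (z.re / 2) ^ 2 + (z.im / 2) ^ 2 := by
    intro z
    rw [norm_div, div_pow, Complex.sq_norm, Complex.normSq_apply]
    norm_num
    ring
  have d1 : ∀ z : ℂ, ‖z‖ ^ 2 = z.re ^ 2 + z.im ^ 2 := by
    intro z
    rw [Complex.sq_norm, Complex.normSq_apply]
    ring
  simp only [d2]
  simp only [d1]
  simp only [Complex.add_re, Complex.add_im, Complex.sub_re, Complex.sub_im, Complex.re_ofReal_mul,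
    Complex.im_ofReal_mul]
  refine ⟨by linarith, by linarith, by linarith⟩

lemma cs4 (s00 s01 s10 s11 f0 f1 w0 w1 : ℝ) :
    (f0 * (s00 * w0) + f0 * (s01 * w1) + f1 * (s10 * w0) + f1 * (s11 * w1)) ^ 2 ≤
      (s00 ^ 2 + s01 ^ 2 + s10 ^ 2 + s11 ^ 2) * ((f0 ^ 2 + f1 ^ 2) * (w0 ^ 2 + w1 ^ 2)) := by
  have := Finset.sum_mul_sq_le_sq_mul_sq Finset.univ ![s00, s01, s10, s11]
    ![f0 * w0, f0 * w1, f1 * w0, f1 * w1]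
  simp [Fin.sum_univ_four] at this
  calc _ = _ := by ring
    _ ≤ _ := this
    _ = _ := by ring

lemma pw_real (F G G' P q P' q' A1 A2 A3 : ℝ) (hF : 0 ≤ F) (hG : 0 ≤ G) (hG' : 0 ≤ G')
    (hP : 0 ≤ P) (hq : 0 ≤ q) (hP' : 0 ≤ P') (hq' : 0 ≤ q')
    (eG : G ^ 2 = P ^ 2 + q ^ 2) (eG' : G' ^ 2 = P' ^ 2 + q' ^ 2)
    (h1 : A1 ^ 2 ≤ (G ^ 2 / 2) * (F ^ 2 * P' ^ 2)) (h2 : A2 ^ 2 ≤ (F ^ 2 * P ^ 2) * q' ^ 2)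
    (h3 : A3 ^ 2 ≤ (F ^ 2 / 2) * (q ^ 2 * q' ^ 2)) :
    A1 + A2 + A3 ≤ √2 * (F * (G * G')) := by
  have s2 : 0 < √2 := by positivity
  have s22 : √2 ^ 2 = 2 := Real.sq_sqrt (by norm_num)
  have h1' : A1 ≤ (G / √2) * (F * P') := by
    apply le_of_sq_le_sq _ (by positivity)
    rw [mul_pow, div_pow, mul_pow, s22]; exact h1
  have h2' : A2 ≤ F * P * q' := by
    apply le_of_sq_le_sq _ (by positivity)
    rw [mul_pow, mul_pow]; exact h2
  have h3' : A3 ≤ (F / √2) * (q * q') := by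
    apply le_of_sq_le_sq _ (by positivity)
    rw [mul_pow, div_pow, mul_pow, s22]; exact h3
  have key : (G / √2) * P' + (P + q / √2) * q' ≤ √2 * (G * G') := by
    apply le_of_sq_le_sq _ (by positivity)
    have c1 : ((G / √2) * P' + (P + q / √2) * q') ^ 2 ≤
        ((G / √2) ^ 2 + (P + q / √2) ^ 2) * (P' ^ 2 + q' ^ 2) := by
      nlinarith [sq_nonneg ((G / √2) * q' - (P + q / √2) * P')]
    have c2 : (P + q / √2) ^ 2 ≤ 3 / 2 * G ^ 2 := by
      have : (q / √2) ^ 2 = q ^ 2 / 2 := by rw [div_pow, s22]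
      have t : (P + q / √2) ^ 2 ≤ 3 / 2 * (P ^ 2 + 2 * (q / √2) ^ 2) := by
        nlinarith [sq_nonneg (P - 2 * (q / √2))]
      rw [this] at t
      rw [eG]; linarith
    have c3 : (G / √2) ^ 2 = G ^ 2 / 2 := by rw [div_pow, s22]
    rw [c3, ← eG'] at c1
    rw [mul_pow, s22, mul_pow]
    have : 0 ≤ G' ^ 2 := by positivity
    nlinarith
  calc A1 + A2 + A3 ≤ (G / √2) * (F * P') + F * P * q' + (F / √2) * (q * q') := by linarith
    _ = F * ((G / √2) * P' + (P + q / √2) * q') := by ring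
    _ ≤ F * (√2 * (G * G')) := by gcongr
    _ = _ := by ring

lemma pw_cx (f0 f1 t : ℂ) (s00 s01 s10 s11 s02 s12 : ℂ) (w0 w1 w2 : ℂ) (v0 v1 v2 : ℂ)
    (ht : ‖t‖ ^ 2 ≤ (‖f0‖ ^ 2 + ‖f1‖ ^ 2) / 2)
    (hs : ‖s02‖ ^ 2 + ‖s12‖ ^ 2 ≤ ‖w0‖ ^ 2 + ‖w1‖ ^ 2)
    (hh : ‖s00‖ ^ 2 + ‖s01‖ ^ 2 + ‖s10‖ ^ 2 + ‖s11‖ ^ 2 ≤ (‖w0‖ ^ 2 + ‖w1‖ ^ 2 + ‖w2‖ ^ 2) / 2) :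
    ‖f0 * (s00 * v0) + f0 * (s01 * v1) + f1 * (s10 * v0) + f1 * (s11 * v1)
      + (f0 * (s02 * v2) + f1 * (s12 * v2)) + t * (w2 * v2)‖ ≤
    √2 * (√(‖f0‖ ^ 2 + ‖f1‖ ^ 2) * (√(‖w0‖ ^ 2 + ‖w1‖ ^ 2 + ‖w2‖ ^ 2) *
      √(‖v0‖ ^ 2 + ‖v1‖ ^ 2 + ‖v2‖ ^ 2))) := by
  have n1 : ‖f0 * (s00 * v0) + f0 * (s01 * v1) + f1 * (s10 * v0) + f1 * (s11 * v1)‖ ≤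
      ‖f0‖ * (‖s00‖ * ‖v0‖) + ‖f0‖ * (‖s01‖ * ‖v1‖) + ‖f1‖ * (‖s10‖ * ‖v0‖)
        + ‖f1‖ * (‖s11‖ * ‖v1‖) := by
    simp only [← norm_mul]
    exact norm_add₄_le
  have n2 : ‖f0 * (s02 * v2) + f1 * (s12 * v2)‖ ≤
      (‖f0‖ * ‖s02‖ + ‖f1‖ * ‖s12‖) * ‖v2‖ := by
    have := norm_add_le (f0 * (s02 * v2)) (f1 * (s12 * v2))
    simp only [norm_mul] at this
    linarith
  refine (norm_add₃_le).trans ?_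
  rw [norm_mul t, norm_mul w2]
  refine (add_le_add_left (add_le_add n1 n2) _).trans ?_
  have q1 : √(‖f0‖ ^ 2 + ‖f1‖ ^ 2) ^ 2 = ‖f0‖ ^ 2 + ‖f1‖ ^ 2 := Real.sq_sqrt (by positivity)
  have q2 : √(‖w0‖ ^ 2 + ‖w1‖ ^ 2 + ‖w2‖ ^ 2) ^ 2 = ‖w0‖ ^ 2 + ‖w1‖ ^ 2 + ‖w2‖ ^ 2 :=
    Real.sq_sqrt (by positivity)
  have q3 : √(‖v0‖ ^ 2 + ‖v1‖ ^ 2 + ‖v2‖ ^ 2) ^ 2 = ‖v0‖ ^ 2 + ‖v1‖ ^ 2 + ‖v2‖ ^ 2 :=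
    Real.sq_sqrt (by positivity)
  have q4 : √(‖w0‖ ^ 2 + ‖w1‖ ^ 2) ^ 2 = ‖w0‖ ^ 2 + ‖w1‖ ^ 2 := Real.sq_sqrt (by positivity)
  have q5 : √(‖v0‖ ^ 2 + ‖v1‖ ^ 2) ^ 2 = ‖v0‖ ^ 2 + ‖v1‖ ^ 2 := Real.sq_sqrt (by positivity)
  apply pw_real (P := √(‖w0‖ ^ 2 + ‖w1‖ ^ 2)) (q := ‖w2‖) (P' := √(‖v0‖ ^ 2 + ‖v1‖ ^ 2)) (q' := ‖v2‖)
  any_goals positivity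
  · rw [q2, q4]
  · rw [q3, q5]
  · refine (cs4 _ _ _ _ _ _ _ _).trans ?_
    rw [q1, q2, q5]
    gcongr
  · rw [mul_pow, q1, q4]
    gcongr
    have : (‖f0‖ * ‖s02‖ + ‖f1‖ * ‖s12‖) ^ 2 ≤ (‖f0‖ ^ 2 + ‖f1‖ ^ 2) * (‖s02‖ ^ 2 + ‖s12‖ ^ 2) := by
      nlinarith [sq_nonneg (‖f0‖ * ‖s12‖ - ‖f1‖ * ‖s02‖)]
    refine this.trans ?_
    gcongr
  · rw [mul_pow, mul_pow, q1]
    gcongr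


/-- curl as Schwartz functions -/
def curlS (u : Fin 3 → 𝓢(E3, ℝ)) : Fin 3 → 𝓢(E3, ℝ) :=
  ![dS 1 (u 2) - dS 2 (u 1), dS 2 (u 0) - dS 0 (u 2), dS 0 (u 1) - dS 1 (u 0)]

/-- strain as Schwartz functions -/
def strS (u : Fin 3 → 𝓢(E3, ℝ)) (i j : Fin 3) : 𝓢(E3, ℝ) :=
  (1 / 2 : ℝ) • (dS i (u j) + dS j (u i))

lemma curl_eq (u : Fin 3 → 𝓢(E3, ℝ)) (k : Fin 3) : curl (fun i => ⇑(u i)) k = ⇑(curlS u k) := by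
  fin_cases k <;> ext x <;> simp [curl, curlS, pd_eq]

lemma strain_eq (u : Fin 3 → 𝓢(E3, ℝ)) (i j : Fin 3) :
    strain (fun i => ⇑(u i)) i j = ⇑(strS u i j) := by
  ext x
  simp [strain, strS, pd_eq]
  ring

/-- scaled Fourier transform of the velocity -/
def av (u : Fin 3 → 𝓢(E3, ℝ)) (j : Fin 3) (ξ : E3) : ℂ := 2 * π * Complex.I * FT (u j) ξ

lemma FTd (u : Fin 3 → 𝓢(E3, ℝ)) (i j : Fin 3) (ξ : E3) :
    FT (dS i (u j)) ξ = (ξ i : ℂ) * av u j ξ := FT_dS i (u j) ξ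

lemma FTstr (u : Fin 3 → 𝓢(E3, ℝ)) (i j : Fin 3) (ξ : E3) :
    FT (strS u i j) ξ = ((ξ i : ℂ) * av u j ξ + (ξ j : ℂ) * av u i ξ) / 2 := by
  rw [strS, FT_smul, FT_add]
  simp only [add_apply, FTd]
  push_cast
  ring

lemma FTc0 (u : Fin 3 → 𝓢(E3, ℝ)) (ξ : E3) :
    FT (curlS u 0) ξ = (ξ 1 : ℂ) * av u 2 ξ - (ξ 2 : ℂ) * av u 1 ξ := by
  change FT (dS 1 (u 2) - dS 2 (u 1)) ξ = _
  rw [FT_sub]; simp only [sub_apply, FTd]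

lemma FTc1 (u : Fin 3 → 𝓢(E3, ℝ)) (ξ : E3) :
    FT (curlS u 1) ξ = (ξ 2 : ℂ) * av u 0 ξ - (ξ 0 : ℂ) * av u 2 ξ := by
  change FT (dS 2 (u 0) - dS 0 (u 2)) ξ = _
  rw [FT_sub]; simp only [sub_apply, FTd]

lemma FTc2 (u : Fin 3 → 𝓢(E3, ℝ)) (ξ : E3) :
    FT (curlS u 2) ξ = (ξ 0 : ℂ) * av u 1 ξ - (ξ 1 : ℂ) * av u 0 ξ := by
  change FT (dS 0 (u 1) - dS 1 (u 0)) ξ = _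
  rw [FT_sub]; simp only [sub_apply, FTd]

lemma div_av (u : Fin 3 → 𝓢(E3, ℝ)) (hdiv : ∀ x : E3, ∑ i, pd i (⇑(u i)) x = 0) (ξ : E3) :
    (ξ 0 : ℂ) * av u 0 ξ + ξ 1 * av u 1 ξ + ξ 2 * av u 2 ξ = 0 := by
  have h : dS 0 (u 0) + dS 1 (u 1) + dS 2 (u 2) = 0 := by
    ext x
    have := hdiv x
    simpa [Fin.sum_univ_three, pd_eq] using this
  have h2 : FT (dS 0 (u 0) + dS 1 (u 1) + dS 2 (u 2)) ξ = 0 := by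
    rw [h]
    have : FT 0 = 0 := by
      have := FT_sub 0 0
      simpa using this
    rw [this]; rfl
  rw [FT_add, FT_add] at h2
  simpa only [add_apply, FTd] using h2

lemma int_sq (f : 𝓢(E3, ℂ)) (k : ℕ) : Integrable (fun ξ : E3 => ‖ξ‖ ^ k * ‖f ξ‖ ^ 2) := by
  have h1 := f.integrable_pow_mul volume k
  have := h1.bdd_mul (c := SchwartzMap.seminorm ℂ 0 0 f) (f := fun ξ => ‖f ξ‖)
    f.continuous.norm.aestronglyMeasurable
    (Filter.Eventually.of_forall fun p => by
      rw [norm_norm]; exact SchwartzMap.norm_le_seminorm ℂ _ _)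
  refine this.congr (Filter.Eventually.of_forall fun ξ => ?_)
  simp only
  ring

lemma coord_le (ξ : E3) (i : Fin 3) : |ξ i| ≤ ‖ξ‖ := by
  simpa using PiLp.norm_apply_le ξ i

lemma cross_le (u : Fin 3 → 𝓢(E3, ℝ)) (i j k l : Fin 3) (ξ : E3) :
    (2 * π * ‖ξ‖)⁻¹ * ‖(ξ i : ℂ) * av u j ξ - (ξ k : ℂ) * av u l ξ‖ ^ 2 ≤
      4 * π * (‖ξ‖ * ‖FT (u j) ξ‖ ^ 2 + ‖ξ‖ * ‖FT (u l) ξ‖ ^ 2) := by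
  rcases eq_or_ne ξ 0 with rfl | h0
  · simp
  have hp : 0 < ‖ξ‖ := norm_pos_iff.mpr h0
  have n : ∀ j, ‖av u j ξ‖ = 2 * π * ‖FT (u j) ξ‖ := by
    intro j
    simp [av, abs_of_pos pi_pos]
  have b : ∀ i j : Fin 3, ‖(ξ i : ℂ) * av u j ξ‖ ≤ ‖ξ‖ * (2 * π * ‖FT (u j) ξ‖) := by
    intro i j
    rw [norm_mul, n, Complex.norm_real]
    gcongr
    exact coord_le ξ i
  have h1 : ‖(ξ i : ℂ) * av u j ξ - (ξ k : ℂ) * av u l ξ‖ ≤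
      ‖ξ‖ * (2 * π * ‖FT (u j) ξ‖) + ‖ξ‖ * (2 * π * ‖FT (u l) ξ‖) :=
    (norm_sub_le _ _).trans (add_le_add (b i j) (b k l))
  have h2 : ‖(ξ i : ℂ) * av u j ξ - (ξ k : ℂ) * av u l ξ‖ ^ 2 ≤
      (2 * π * ‖ξ‖) ^ 2 * (2 * (‖FT (u j) ξ‖ ^ 2 + ‖FT (u l) ξ‖ ^ 2)) := by
    calc _ ≤ (‖ξ‖ * (2 * π * ‖FT (u j) ξ‖) + ‖ξ‖ * (2 * π * ‖FT (u l) ξ‖)) ^ 2 := by gcongr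
      _ = (2 * π * ‖ξ‖) ^ 2 * (‖FT (u j) ξ‖ + ‖FT (u l) ξ‖) ^ 2 := by ring
      _ ≤ _ := by
        gcongr
        exact add_sq_le
  calc _ ≤ (2 * π * ‖ξ‖)⁻¹ * ((2 * π * ‖ξ‖) ^ 2 * (2 * (‖FT (u j) ξ‖ ^ 2 + ‖FT (u l) ξ‖ ^ 2))) := by
        gcongr
    _ = _ := by field_simp; ring

lemma int_cross (u : Fin 3 → 𝓢(E3, ℝ)) (f : 𝓢(E3, ℂ)) (i j k l : Fin 3)
    (hf : ∀ ξ : E3, f ξ = (ξ i : ℂ) * av u j ξ - (ξ k : ℂ) * av u l ξ) :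
    Integrable (fun ξ : E3 => (2 * π * ‖ξ‖)⁻¹ * ‖f ξ‖ ^ 2) := by
  have h1 := ((int_sq (FT (u j)) 1).add (int_sq (FT (u l)) 1)).const_mul (4 * π)
  refine h1.mono' ?_ ?_
  · apply AEMeasurable.aestronglyMeasurable
    have := f.continuous.measurable
    fun_prop
  · refine Filter.Eventually.of_forall fun ξ => ?_
    rw [Real.norm_of_nonneg (by positivity), hf]
    simpa using cross_le u i j k l ξ

lemma hsV_one (W : Fin 3 → 𝓢(E3, ℝ)) :
    hsV 1 (fun k => ⇑(W k)) = ∫ ξ : E3, (2 * π * ‖ξ‖) ^ 2 *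
      √(‖FT (W 0) ξ‖ ^ 2 + ‖FT (W 1) ξ‖ ^ 2 + ‖FT (W 2) ξ‖ ^ 2) ^ 2 := by
  unfold hsV
  congr 1
  ext ξ
  rw [Real.sq_sqrt (by positivity)]
  simp only [ft_eq, Fin.sum_univ_three, mul_one, Real.rpow_two]

lemma hsV_half (w : Fin 3 → E3 → ℝ) (W : Fin 3 → 𝓢(E3, ℝ)) (h0 : w 0 = W 0) (h1 : w 1 = W 1)
    (h2 : w 2 = fun _ => 0) :
    hsV (-(1/2)) w = ∫ ξ : E3, (2 * π * ‖ξ‖)⁻¹ *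
      √(‖FT (W 0) ξ‖ ^ 2 + ‖FT (W 1) ξ‖ ^ 2) ^ 2 := by
  unfold hsV
  congr 1
  ext ξ
  rw [Real.sq_sqrt (by positivity)]
  have : ft (fun _ => 0) ξ = 0 := by
    simp [ft, Real.fourier_eq]
  simp only [Fin.sum_univ_three, h0, h1, h2, ft_eq, this]
  norm_num [Real.rpow_neg_one]

lemma tri_int_real (f g h : 𝓢(E3, ℝ)) : Integrable (fun x : E3 => f x * (g x * h x)) := by
  have bd : ∀ (f : 𝓢(E3, ℝ)) (φ : E3 → ℝ), Integrable φ → Integrable (fun x => f x * φ x) := by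
    intro f φ hφ
    exact hφ.bdd_mul (c := SchwartzMap.seminorm ℝ 0 0 f) f.continuous.aestronglyMeasurable
      (Filter.Eventually.of_forall fun p => SchwartzMap.norm_le_seminorm ℝ _ _)
  exact bd f _ (bd g _ h.integrable)

lemma sum7 {α 𝕜 : Type*} [MeasurableSpace α] [RCLike 𝕜] {μ : Measure α}
    {a b c d e f g : α → 𝕜} (ha : Integrable a μ) (hb : Integrable b μ) (hc : Integrable c μ)
    (hd : Integrable d μ) (he : Integrable e μ) (hf : Integrable f μ) (hg : Integrable g μ) :
    ∫ x, (a x + b x + c x + d x + (e x + f x) + g x) ∂μ =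
      (∫ x, a x ∂μ) + (∫ x, b x ∂μ) + (∫ x, c x ∂μ) + (∫ x, d x ∂μ) +
      ((∫ x, e x ∂μ) + (∫ x, f x ∂μ)) + (∫ x, g x ∂μ) := by
  have h1 : Integrable (fun x => a x + b x) μ := ha.add hb
  have h2 : Integrable (fun x => a x + b x + c x) μ := h1.add hc
  have h3 : Integrable (fun x => a x + b x + c x + d x) μ := h2.add hd
  have h4 : Integrable (fun x => e x + f x) μ := he.add hf
  have h5 : Integrable (fun x => a x + b x + c x + d x + (e x + f x)) μ := h3.add h4
  rw [integral_add h5 hg, integral_add h3 h4, integral_add h2 hd, integral_add h1 hc,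
    integral_add ha hb, integral_add he hf]

lemma stretch (u : Fin 3 → 𝓢(E3, ℝ)) (hdiv : ∀ x : E3, ∑ i, pd i (⇑(u i)) x = 0)
    (w : Fin 3 → E3 → ℝ) (h0 : w 0 = curlS u 0) (h1 : w 1 = curlS u 1)
    (h2 : w 2 = fun _ => 0) :
    ∫ x : E3, ∑ k, ∑ j, curlS u k x * (strS u k j x * curlS u j x) ≤
      (1 / 2) * √(hsV (-(1/2)) w) * hsV 1 (fun k => ⇑(curlS u k)) := by
  rw [hsV_one, hsV_half w (curlS u) h0 h1 h2]
  set W := curlS u with hW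
  set F : E3 → ℝ := fun ξ => √(‖FT (W 0) ξ‖ ^ 2 + ‖FT (W 1) ξ‖ ^ 2) with hF
  set G : E3 → ℝ := fun ξ => √(‖FT (W 0) ξ‖ ^ 2 + ‖FT (W 1) ξ‖ ^ 2 + ‖FT (W 2) ξ‖ ^ 2) with hG
  have c0 := (FT (W 0)).continuous
  have c1 := (FT (W 1)).continuous
  have c2 := (FT (W 2)).continuous
  have hFc : Continuous F := by fun_prop
  have hGc : Continuous G := by fun_prop
  have hX : Integrable (fun ξ : E3 => (2 * π * ‖ξ‖)⁻¹ * F ξ ^ 2) := by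
    refine ((int_cross u (FT (W 0)) 1 2 2 1 (FTc0 u)).add
      (int_cross u (FT (W 1)) 2 0 0 2 (FTc1 u))).congr (Filter.Eventually.of_forall fun ξ => ?_)
    simp only [hF, Pi.add_apply]
    rw [Real.sq_sqrt (by positivity)]
    ring
  have hY : Integrable (fun ξ : E3 => (2 * π * ‖ξ‖) ^ 2 * G ξ ^ 2) := by
    refine ((((int_sq (FT (W 0)) 2).add (int_sq (FT (W 1)) 2)).add
      (int_sq (FT (W 2)) 2)).const_mul ((2 * π) ^ 2)).congr (Filter.Eventually.of_forall fun ξ => ?_)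
    simp only [hG, Pi.add_apply]
    rw [Real.sq_sqrt (by positivity)]
    ring
  have hT := trilin F G hFc.measurable hGc.measurable (fun x => Real.sqrt_nonneg _)
    (fun x => Real.sqrt_nonneg _) hX hY
  set X := ∫ ξ : E3, (2 * π * ‖ξ‖)⁻¹ * F ξ ^ 2 with hXd
  set Y := ∫ ξ : E3, (2 * π * ‖ξ‖) ^ 2 * G ξ ^ 2 with hYd
  have hX0 : 0 ≤ X := integral_nonneg fun ξ => by positivity
  have hY0 : 0 ≤ Y := integral_nonneg fun ξ => by positivity
  set D02 : 𝓢(E3, ℝ) := (2:ℝ) • strS u 0 2 with hD02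
  set D12 : 𝓢(E3, ℝ) := (2:ℝ) • strS u 1 2 with hD12
  have hsym : ∀ i j, strS u i j = strS u j i := by
    intro i j; rw [strS, strS, add_comm]
  -- the integrand as a sum of seven triple products
  have e1 : ∀ x : E3, ∑ k, ∑ j, W k x * (strS u k j x * W j x) =
      W 0 x * (strS u 0 0 x * W 0 x) + W 0 x * (strS u 0 1 x * W 1 x)
      + W 1 x * (strS u 1 0 x * W 0 x) + W 1 x * (strS u 1 1 x * W 1 x)
      + (W 0 x * (D02 x * W 2 x) + W 1 x * (D12 x * W 2 x)) + strS u 2 2 x * (W 2 x * W 2 x) := by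
    intro x
    simp only [Fin.sum_univ_three, hD02, hD12, hsym 2 0, hsym 2 1, smul_apply, smul_eq_mul]
    ring
  simp only [e1]
  have I1 := tri_int_real
  have e2 : ((∫ x : E3, (W 0 x * (strS u 0 0 x * W 0 x) + W 0 x * (strS u 0 1 x * W 1 x)
      + W 1 x * (strS u 1 0 x * W 0 x) + W 1 x * (strS u 1 1 x * W 1 x)
      + (W 0 x * (D02 x * W 2 x) + W 1 x * (D12 x * W 2 x)) + strS u 2 2 x * (W 2 x * W 2 x)) : ℝ) : ℂ)
      = ∫ p : E3 × E3, (FT (W 0) (-(p.1 + p.2)) * (FT (strS u 0 0) p.1 * FT (W 0) p.2)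
      + FT (W 0) (-(p.1 + p.2)) * (FT (strS u 0 1) p.1 * FT (W 1) p.2)
      + FT (W 1) (-(p.1 + p.2)) * (FT (strS u 1 0) p.1 * FT (W 0) p.2)
      + FT (W 1) (-(p.1 + p.2)) * (FT (strS u 1 1) p.1 * FT (W 1) p.2)
      + (FT (W 0) (-(p.1 + p.2)) * (FT D02 p.1 * FT (W 2) p.2)
      + FT (W 1) (-(p.1 + p.2)) * (FT D12 p.1 * FT (W 2) p.2))
      + FT (strS u 2 2) (-(p.1 + p.2)) * (FT (W 2) p.1 * FT (W 2) p.2)) := by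
    have J := tri_integrable
    rw [sum7 (I1 _ _ _) (I1 _ _ _) (I1 _ _ _) (I1 _ _ _) (I1 _ _ _) (I1 _ _ _) (I1 _ _ _),
      sum7 (J _ _ _) (J _ _ _) (J _ _ _) (J _ _ _) (J _ _ _) (J _ _ _) (J _ _ _)]
    simp only [Complex.ofReal_add, tri_identity]
  refine (le_abs_self _).trans ?_
  rw [← Real.norm_eq_abs, ← Complex.norm_real, e2]
  refine (norm_integral_le_lintegral_norm _).trans ?_
  have hR0 : 0 ≤ 1 / 2 * √X * Y := by positivity
  refine ENNReal.toReal_le_of_le_ofReal hR0 ?_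
  have hpw : ∀ p : E3 × E3, ‖(FT (W 0) (-(p.1 + p.2)) * (FT (strS u 0 0) p.1 * FT (W 0) p.2)
      + FT (W 0) (-(p.1 + p.2)) * (FT (strS u 0 1) p.1 * FT (W 1) p.2)
      + FT (W 1) (-(p.1 + p.2)) * (FT (strS u 1 0) p.1 * FT (W 0) p.2)
      + FT (W 1) (-(p.1 + p.2)) * (FT (strS u 1 1) p.1 * FT (W 1) p.2)
      + (FT (W 0) (-(p.1 + p.2)) * (FT D02 p.1 * FT (W 2) p.2)
      + FT (W 1) (-(p.1 + p.2)) * (FT D12 p.1 * FT (W 2) p.2))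
      + FT (strS u 2 2) (-(p.1 + p.2)) * (FT (W 2) p.1 * FT (W 2) p.2))‖ ≤
      √2 * (F (-(p.1 + p.2)) * (G p.1 * G p.2)) := by
    intro p
    obtain ⟨a1, -, -⟩ := alg_cx _ _ _ _ _ _ (div_av u hdiv (-(p.1 + p.2)))
    obtain ⟨-, b2, b3⟩ := alg_cx _ _ _ _ _ _ (div_av u hdiv p.1)
    apply pw_cx
    · rw [FTstr, hW, FTc0, FTc1, ← two_mul, mul_div_cancel_left₀ _ (two_ne_zero)]
      exact a1
    · rw [hD02, hD12, FT_smul, FT_smul, FTstr, FTstr, hW, FTc0, FTc1]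
      push_cast
      rw [mul_div_cancel₀ _ (two_ne_zero), mul_div_cancel₀ _ (two_ne_zero)]
      exact b2
    · rw [FTstr, FTstr, FTstr, FTstr, hW, FTc0, FTc1, FTc2, ← two_mul,
        mul_div_cancel_left₀ _ (two_ne_zero), ← two_mul, mul_div_cancel_left₀ _ (two_ne_zero)]
      exact b3
  calc _ ≤ ∫⁻ p : E3 × E3, ENNReal.ofReal (√2 * (F (-(p.1 + p.2)) * (G p.1 * G p.2))) := by
        apply lintegral_mono
        intro p
        exact ENNReal.ofReal_le_ofReal (hpw p)
    _ = ENNReal.ofReal √2 * ∫⁻ p : E3 × E3, ENNReal.ofReal (F (-(p.1 + p.2)) * (G p.1 * G p.2)) := by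
        rw [← lintegral_const_mul' _ _ ENNReal.ofReal_ne_top]
        apply lintegral_congr
        intro p
        rw [ENNReal.ofReal_mul (by positivity)]
    _ ≤ ENNReal.ofReal √2 * ENNReal.ofReal (√2 / 4 * √X * Y) := by gcongr
    _ = ENNReal.ofReal (1 / 2 * √X * Y) := by
        rw [← ENNReal.ofReal_mul (by positivity)]
        congr 1
        have : √2 * √2 = 2 := Real.mul_self_sqrt (by norm_num)
        linear_combination (1 / 4 * √X * Y) * this


/-- product of Schwartz functions -/
def mulS (f g : 𝓢(E3, ℝ)) : 𝓢(E3, ℝ) := SchwartzMap.pairing (ContinuousLinearMap.mul ℝ ℝ) f g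

lemma mulS_apply (f g : 𝓢(E3, ℝ)) (x : E3) : mulS f g x = f x * g x := rfl

lemma dS_mulS (i : Fin 3) (f g : 𝓢(E3, ℝ)) (x : E3) :
    dS i (mulS f g) x = dS i f x * g x + f x * dS i g x := by
  rw [← pd_eq, ← pd_eq, ← pd_eq]
  unfold pd
  have h : HasFDerivAt (fun y => f y * g y) _ x := (f.hasFDerivAt x).mul (g.hasFDerivAt x)
  have h2 : ⇑(mulS f g) = fun y => f y * g y := rfl
  rw [h2, h.fderiv]
  simp
  ring

lemma mul_integrable (f g : 𝓢(E3, ℝ)) : Integrable (fun x : E3 => f x * g x) :=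
  (mulS f g).integrable

lemma parts (i : Fin 3) (f g : 𝓢(E3, ℝ)) :
    ∫ x : E3, f x * dS i g x = -∫ x : E3, dS i f x * g x :=
  SchwartzMap.integral_mul_lineDerivOp_right_eq_neg_left f g (ee i)

lemma conv_zero (u : Fin 3 → 𝓢(E3, ℝ)) (hdiv : ∀ x : E3, ∑ i, pd i (⇑(u i)) x = 0)
    (W : 𝓢(E3, ℝ)) : ∫ x : E3, W x * ∑ i, u i x * dS i W x = 0 := by
  have h : ∀ i, 2 * ∫ x : E3, W x * (u i x * dS i W x) = -∫ x : E3, W x * (dS i (u i) x * W x) := by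
    intro i
    have h1 := parts i (mulS W (u i)) W
    have e : ∀ x, dS i (mulS W (u i)) x * W x =
        W x * (u i x * dS i W x) + W x * (dS i (u i) x * W x) := by
      intro x; rw [dS_mulS]; ring
    simp only [e, mulS_apply] at h1
    rw [integral_add (tri_int_real _ _ _) (tri_int_real _ _ _)] at h1
    have e2 : ∫ x : E3, W x * u i x * dS i W x = ∫ x : E3, W x * (u i x * dS i W x) := by
      simp only [mul_assoc]
    rw [e2] at h1
    linarith
  have h3 : 2 * ∫ x : E3, W x * ∑ i, u i x * dS i W x = 0 := by
    simp only [Finset.mul_sum]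
    rw [integral_finsetSum _ fun i _ => tri_int_real _ _ _, Finset.mul_sum]
    simp only [h]
    rw [Finset.sum_neg_distrib, ← integral_finsetSum _ fun i _ => tri_int_real _ _ _]
    have : ∀ x, ∑ i, W x * (dS i (u i) x * W x) = 0 := by
      intro x
      have := hdiv x
      simp only [pd_eq] at this
      rw [← Finset.mul_sum, ← Finset.sum_mul, this]; ring
    simp [this]
  linarith

lemma planch (f : 𝓢(E3, ℝ)) : ∫ x : E3, f x * f x = ∫ ξ : E3, ‖FT f ξ‖ ^ 2 := by
  rw [FT, SchwartzMap.integral_norm_sq_fourier]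
  apply integral_congr_ae
  refine Filter.Eventually.of_forall fun x => ?_
  simp [cx_apply, sq]

lemma lap_int (W : 𝓢(E3, ℝ)) : ∫ x : E3, W x * ∑ i, dS i (dS i W) x =
    -∫ ξ : E3, (2 * π * ‖ξ‖) ^ 2 * ‖FT W ξ‖ ^ 2 := by
  simp only [Finset.mul_sum]
  rw [integral_finsetSum _ fun i _ => mul_integrable _ _]
  have hp : ∀ i, ∫ x : E3, W x * dS i (dS i W) x = -∫ ξ : E3, ‖FT (dS i W) ξ‖ ^ 2 := by
    intro i; rw [parts, planch]
  simp only [hp]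
  rw [Finset.sum_neg_distrib, ← integral_finsetSum]
  · congr 1
    apply integral_congr_ae
    refine Filter.Eventually.of_forall fun ξ => ?_
    have : ‖ξ‖ ^ 2 = ∑ i, (ξ i) ^ 2 := by
      rw [EuclideanSpace.norm_sq_eq]; simp
    simp only [FT_dS, norm_mul, Complex.norm_real, mul_pow, this, Finset.sum_mul, Finset.mul_sum]
    refine Finset.sum_congr rfl fun i _ => ?_
    simp
    ring
  · intro i _
    simpa using int_sq (FT (dS i W)) 0

lemma hsV_one_sum (W : Fin 3 → 𝓢(E3, ℝ)) :
    hsV 1 (fun k => ⇑(W k)) = ∑ k, ∫ ξ : E3, (2 * π * ‖ξ‖) ^ 2 * ‖FT (W k) ξ‖ ^ 2 := by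
  rw [← integral_finsetSum]
  · unfold hsV
    apply integral_congr_ae
    refine Filter.Eventually.of_forall fun ξ => ?_
    simp only [ft_eq, mul_one, Real.rpow_two, Finset.mul_sum]
  · intro i _
    refine ((int_sq (FT (W i)) 2).const_mul ((2 * π) ^ 2)).congr
      (Filter.Eventually.of_forall fun ξ => ?_)
    simp only
    ring

/-- right hand side of the vorticity equation -/
def rhs (ν : ℝ) (u : Fin 3 → 𝓢(E3, ℝ)) (k : Fin 3) (x : E3) : ℝ :=
  ν * (∑ i, dS i (dS i (curlS u k)) x) - (∑ i, u i x * dS i (curlS u k) x)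
    + ∑ j, strS u k j x * curlS u j x

lemma energy (ν : ℝ) (u : Fin 3 → 𝓢(E3, ℝ)) (hdiv : ∀ x : E3, ∑ i, pd i (⇑(u i)) x = 0) :
    ∫ x : E3, ∑ k, 2 * (curlS u k x * rhs ν u k x) =
      -2 * ν * hsV 1 (fun k => ⇑(curlS u k)) +
      2 * ∫ x : E3, ∑ k, ∑ j, curlS u k x * (strS u k j x * curlS u j x) := by
  set W := curlS u
  have i1 : ∀ k, Integrable fun x : E3 => W k x * ∑ i, dS i (dS i (W k)) x := by
    intro k
    simp only [Finset.mul_sum]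
    exact integrable_finsetSum _ fun i _ => mul_integrable _ _
  have i2 : ∀ k, Integrable fun x : E3 => W k x * ∑ i, u i x * dS i (W k) x := by
    intro k
    simp only [Finset.mul_sum]
    exact integrable_finsetSum _ fun i _ => tri_int_real _ _ _
  have i3 : ∀ k, Integrable fun x : E3 => ∑ j, W k x * (strS u k j x * W j x) := by
    intro k
    exact integrable_finsetSum _ fun i _ => tri_int_real _ _ _
  have e : ∀ k x, 2 * (W k x * rhs ν u k x) =
      (2 * ν) * (W k x * ∑ i, dS i (dS i (W k)) x) - 2 * (W k x * ∑ i, u i x * dS i (W k) x)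
      + 2 * ∑ j, W k x * (strS u k j x * W j x) := by
    intro k x
    rw [← Finset.mul_sum, rhs]
    ring
  simp only [e]
  have j1 : ∀ k, Integrable fun x : E3 => (2 * ν) * (W k x * ∑ i, dS i (dS i (W k)) x)
      - 2 * (W k x * ∑ i, u i x * dS i (W k) x) := fun k =>
    ((i1 k).const_mul _).sub ((i2 k).const_mul _)
  have j2 : ∀ k, Integrable fun x : E3 => (2 * ν) * (W k x * ∑ i, dS i (dS i (W k)) x)
      - 2 * (W k x * ∑ i, u i x * dS i (W k) x) + 2 * ∑ j, W k x * (strS u k j x * W j x) :=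
    fun k => (j1 k).add ((i3 k).const_mul 2)
  rw [integral_finsetSum _ fun k _ => j2 k,
    integral_finsetSum _ fun k _ => i3 k]
  have e2 : ∀ k, ∫ x : E3, ((2 * ν) * (W k x * ∑ i, dS i (dS i (W k)) x)
      - 2 * (W k x * ∑ i, u i x * dS i (W k) x) + 2 * ∑ j, W k x * (strS u k j x * W j x)) =
      -2 * ν * (∫ ξ : E3, (2 * π * ‖ξ‖) ^ 2 * ‖FT (W k) ξ‖ ^ 2) +
      2 * ∫ x : E3, ∑ j, W k x * (strS u k j x * W j x) := by
    intro k
    rw [integral_add (j1 k) ((i3 k).const_mul 2),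
      integral_sub ((i1 k).const_mul _) ((i2 k).const_mul _), integral_const_mul,
      integral_const_mul, integral_const_mul, lap_int, conv_zero u hdiv]
    ring
  rw [hsV_one_sum]
  rw [Finset.sum_congr rfl fun k _ => e2 k, Finset.sum_add_distrib, Finset.mul_sum, Finset.mul_sum]


/-- uniform boundedness of all Schwartz seminorms of a family -/
def SB (K : Set ℝ) (f : ℝ → 𝓢(E3, ℝ)) : Prop :=
  ∀ k n : ℕ, ∃ C : ℝ, ∀ t ∈ K, SchwartzMap.seminorm ℝ k n (f t) ≤ C

lemma SB.vn {K : Set ℝ} {f : ℝ → 𝓢(E3, ℝ)} :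
    SB K f ↔ Bornology.IsVonNBounded ℝ (f '' K) := by
  rw [(schwartz_withSeminorms ℝ E3 ℝ).isVonNBounded_iff_seminorm_bounded]
  constructor
  · rintro h ⟨k, n⟩
    obtain ⟨C, hC⟩ := h k n
    refine ⟨max C 0 + 1, by positivity, ?_⟩
    rintro _ ⟨t, ht, rfl⟩
    have := hC t ht
    have h2 := le_max_left C 0
    change SchwartzMap.seminorm ℝ k n (f t) < _
    linarith
  · intro h k n
    obtain ⟨r, -, hr⟩ := h ⟨k, n⟩
    exact ⟨r, fun t ht => (hr _ ⟨t, ht, rfl⟩).le⟩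

lemma SB.dS {K : Set ℝ} {f : ℝ → 𝓢(E3, ℝ)} (h : SB K f) (i : Fin 3) :
    SB K (fun t => dS i (f t)) := by
  rw [SB.vn] at h ⊢
  have := h.image (LineDeriv.lineDerivOpCLM ℝ 𝓢(E3, ℝ) (ee i))
  rw [Set.image_image] at this
  exact this

lemma SB.sub {K : Set ℝ} {f g : ℝ → 𝓢(E3, ℝ)} (hf : SB K f) (hg : SB K g) :
    SB K (fun t => f t - g t) := by
  intro k n
  obtain ⟨C, hC⟩ := hf k n
  obtain ⟨D, hD⟩ := hg k n
  exact ⟨C + D, fun t ht => (map_sub_le_add _ _ _).trans (add_le_add (hC t ht) (hD t ht))⟩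

lemma SB.add {K : Set ℝ} {f g : ℝ → 𝓢(E3, ℝ)} (hf : SB K f) (hg : SB K g) :
    SB K (fun t => f t + g t) := by
  intro k n
  obtain ⟨C, hC⟩ := hf k n
  obtain ⟨D, hD⟩ := hg k n
  exact ⟨C + D, fun t ht => (map_add_le_add _ _ _).trans (add_le_add (hC t ht) (hD t ht))⟩

lemma SB.smul {K : Set ℝ} {f : ℝ → 𝓢(E3, ℝ)} (hf : SB K f) (c : ℝ) :
    SB K (fun t => c • f t) := by
  intro k n
  obtain ⟨C, hC⟩ := hf k n
  refine ⟨‖c‖ * C, fun t ht => ?_⟩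
  rw [map_smul_eq_mul]
  gcongr
  exact hC t ht

lemma SB.curlS {K : Set ℝ} {u : ℝ → Fin 3 → 𝓢(E3, ℝ)} (h : ∀ i, SB K (fun t => u t i))
    (k : Fin 3) : SB K (fun t => curlS (u t) k) := by
  fin_cases k
  · exact ((h 2).dS 1).sub ((h 1).dS 2)
  · exact ((h 0).dS 2).sub ((h 2).dS 0)
  · exact ((h 1).dS 0).sub ((h 0).dS 1)

lemma SB.strS {K : Set ℝ} {u : ℝ → Fin 3 → 𝓢(E3, ℝ)} (h : ∀ i, SB K (fun t => u t i))
    (i j : Fin 3) : SB K (fun t => strS (u t) i j) :=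
  (((h j).dS i).add ((h i).dS j)).smul _

lemma SB.bdd {K : Set ℝ} {f : ℝ → 𝓢(E3, ℝ)} (h : SB K f) :
    ∃ C : ℝ, 0 ≤ C ∧ ∀ t ∈ K, ∀ x, |f t x| ≤ C := by
  obtain ⟨C, hC⟩ := h 0 0
  refine ⟨max C 0, le_max_right _ _, fun t ht x => ?_⟩
  exact (SchwartzMap.norm_le_seminorm ℝ (f t) x).trans ((hC t ht).trans (le_max_left _ _))

lemma SB.decay {K : Set ℝ} {f : ℝ → 𝓢(E3, ℝ)} (h : SB K f) :
    ∃ C : ℝ, 0 ≤ C ∧ ∀ t ∈ K, ∀ x, |f t x| ≤ C * (1 + ‖x‖) ^ (-4 : ℝ) := by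
  rw [SB.vn, (schwartz_withSeminorms ℝ E3 ℝ).isVonNBounded_iff_finset_seminorm_bounded] at h
  obtain ⟨r, hr, h⟩ := h (Finset.Iic (4, 0))
  refine ⟨2 ^ 4 * r, by positivity, fun t ht x => ?_⟩
  have h1 := SchwartzMap.one_add_le_sup_seminorm_apply (𝕜 := ℝ) (m := (4, 0)) (k := 4) (n := 0)
    le_rfl le_rfl (f t) x
  have h2 : (Finset.Iic (4, 0)).sup (fun m : ℕ × ℕ => SchwartzMap.seminorm ℝ m.1 m.2) (f t) ≤ r :=
    (h _ ⟨t, ht, rfl⟩).le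
  rw [norm_iteratedFDeriv_zero] at h1
  have h3 : (1 + ‖x‖) ^ 4 * |f t x| ≤ 2 ^ 4 * r := by
    refine h1.trans ?_
    gcongr
  have hp : 0 < (1 + ‖x‖) := by positivity
  rw [Real.rpow_neg hp.le, show (4:ℝ) = ((4:ℕ):ℝ) by norm_num, Real.rpow_natCast,
    ← div_eq_mul_inv, le_div_iff₀ (by positivity)]
  linarith

lemma rhs_bdd (ν : ℝ) {K : Set ℝ} {u : ℝ → Fin 3 → 𝓢(E3, ℝ)} (h : ∀ i, SB K (fun t => u t i))
    (k : Fin 3) : ∃ C : ℝ, 0 ≤ C ∧ ∀ t ∈ K, ∀ x, |rhs ν (u t) k x| ≤ C := by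
  choose A hA0 hA using fun i => (((SB.curlS h k).dS i).dS i).bdd
  choose B hB0 hB using fun i => ((SB.curlS h k).dS i).bdd
  choose D hD0 hD using fun i => (h i).bdd
  choose S hS0 hS using fun j => (SB.strS h k j).bdd
  choose W hW0 hW using fun j => (SB.curlS h j).bdd
  refine ⟨|ν| * (∑ i, A i) + (∑ i, D i * B i) + ∑ j, S j * W j, ?_, fun t ht x => ?_⟩
  · exact add_nonneg (add_nonneg (mul_nonneg (abs_nonneg _) (Finset.sum_nonneg fun i _ => hA0 i))
      (Finset.sum_nonneg fun i _ => mul_nonneg (hD0 i) (hB0 i)))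
      (Finset.sum_nonneg fun i _ => mul_nonneg (hS0 i) (hW0 i))
  · rw [rhs]
    refine (abs_add_le _ _).trans (add_le_add ((abs_sub _ _).trans (add_le_add ?_ ?_)) ?_)
    · rw [abs_mul]
      gcongr
      exact (Finset.abs_sum_le_sum_abs _ _).trans (Finset.sum_le_sum fun i _ => hA i t ht x)
    · refine (Finset.abs_sum_le_sum_abs _ _).trans (Finset.sum_le_sum fun i _ => ?_)
      rw [abs_mul]
      exact mul_le_mul (hD i t ht x) (hB i t ht x) (abs_nonneg _) (hD0 i)
    · refine (Finset.abs_sum_le_sum_abs _ _).trans (Finset.sum_le_sum fun i _ => ?_)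
      rw [abs_mul]
      exact mul_le_mul (hS i t ht x) (hW i t ht x) (abs_nonneg _) (hS0 i)

lemma timeSet_mono {T : ℝ≥0∞} {s t : ℝ} (ht : t ∈ timeSet T) (hs : 0 ≤ s) (hst : s ≤ t) :
    s ∈ timeSet T := ⟨hs, (ENNReal.ofReal_le_ofReal hst).trans_lt ht.2⟩

lemma timeSet_gt {T : ℝ≥0∞} {t : ℝ} (ht : t ∈ timeSet T) : ∃ b ∈ timeSet T, t < b := by
  obtain ⟨r, h1, h2⟩ := ENNReal.lt_iff_exists_nnreal_btwn.mp ht.2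
  refine ⟨r, ⟨r.2, by simpa using h2⟩, ?_⟩
  rw [← ENNReal.ofReal_coe_nnreal] at h1
  exact lt_of_not_ge fun h => absurd (ENNReal.ofReal_le_ofReal h) (not_le.mpr h1)

lemma timeSet_ud {T : ℝ≥0∞} (hT : 0 < T) : UniqueDiffOn ℝ (timeSet T) := by
  have h0 : (0:ℝ) ∈ timeSet T := ⟨le_rfl, by simpa using hT⟩
  obtain ⟨b, hb, hb0⟩ := timeSet_gt h0
  apply uniqueDiffOn_convex
  · apply Set.OrdConnected.convex
    constructor
    intro x hx y hy z hz
    exact timeSet_mono hy (hx.1.trans hz.1) hz.2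
  · have : Set.Ioo 0 b ⊆ interior (timeSet T) :=
      interior_maximal (fun z hz => timeSet_mono hb hz.1.le hz.2.le) isOpen_Ioo
    exact ⟨b / 2, this ⟨by linarith, by linarith⟩⟩

lemma pd_diff {T : ℝ≥0∞} (hT : 0 < T) (v : ℝ → 𝓢(E3, ℝ))
    (hv : ContDiffOn ℝ (⊤ : ℕ∞) (fun p : ℝ × E3 => v p.1 p.2) (timeSet T ×ˢ Set.univ))
    (i : Fin 3) (x : E3) {t : ℝ} (ht : t ∈ timeSet T) :
    DifferentiableWithinAt ℝ (fun s => dS i (v s) x) (timeSet T) t := by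
  set F : ℝ × E3 → ℝ := fun p => v p.1 p.2 with hF
  set S : Set (ℝ × E3) := timeSet T ×ˢ Set.univ with hS
  have hud : UniqueDiffOn ℝ S := (timeSet_ud hT).prod uniqueDiffOn_univ
  have hG : ContDiffOn ℝ 1 (fderivWithin ℝ F S) S :=
    hv.fderivWithin hud (by norm_cast)
  have key : ∀ s ∈ timeSet T, dS i (v s) x = fderivWithin ℝ F S (s, x) (0, ee i) := by
    intro s hs
    rw [← pd_eq, pd]
    have h1 : HasFDerivWithinAt F (fderivWithin ℝ F S (s, x)) S (s, x) :=
      ((hv.differentiableOn (by simp)) (s, x) ⟨hs, trivial⟩).hasFDerivWithinAt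
    have h2 : HasFDerivWithinAt (fun y : E3 => (s, y)) (ContinuousLinearMap.inr ℝ ℝ E3)
        Set.univ x := (hasFDerivAt_prodMk_right s x).hasFDerivWithinAt
    have h3 := h1.comp x h2 (fun y _ => ⟨hs, trivial⟩)
    rw [hasFDerivWithinAt_univ] at h3
    have h4 : F ∘ (fun y : E3 => (s, y)) = ⇑(v s) := rfl
    rw [h4] at h3
    rw [h3.fderiv]
    simp
  have h5 : DifferentiableWithinAt ℝ (fun s => fderivWithin ℝ F S (s, x) (0, ee i))
      (timeSet T) t := by
    have h6 : DifferentiableWithinAt ℝ (fun s => fderivWithin ℝ F S (s, x)) (timeSet T) t := by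
      have h7 := (hG.differentiableOn (by simp)) (t, x) ⟨ht, trivial⟩
      have h8 : DifferentiableWithinAt ℝ (fun s : ℝ => (s, x)) (timeSet T) t := by fun_prop
      have hm : Set.MapsTo (fun s : ℝ => (s, x)) (timeSet T) S := fun s hs => ⟨hs, trivial⟩
      exact DifferentiableWithinAt.comp t h7 h8 hm
    exact h6.clm_apply (differentiableWithinAt_const _)
  exact h5.congr key (key t ht)

lemma curl_diff {ν : ℝ} {T : ℝ≥0∞} (hT : 0 < T) (sol : AdmissibleSolution ν T)
    (k : Fin 3) (x : E3) {t : ℝ} (ht : t ∈ timeSet T) :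
    DifferentiableWithinAt ℝ (fun s => curlS (sol.u s) k x) (timeSet T) t := by
  have h : ∀ i j, DifferentiableWithinAt ℝ (fun s => dS i (sol.u s j) x) (timeSet T) t :=
    fun i j => pd_diff hT (fun s => sol.u s j) (sol.smooth j) i x ht
  fin_cases k
  · exact (h 1 2).sub (h 2 1)
  · exact (h 2 0).sub (h 0 2)
  · exact (h 0 1).sub (h 1 0)

lemma curl_hasDeriv {ν : ℝ} {T : ℝ≥0∞} (hT : 0 < T) (sol : AdmissibleSolution ν T)
    (k : Fin 3) (x : E3) {t : ℝ} (ht : t ∈ timeSet T) :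
    HasDerivWithinAt (fun s => curlS (sol.u s) k x) (rhs ν (sol.u t) k x) (timeSet T) t := by
  refine (curl_diff hT sol k x ht).hasDerivWithinAt.congr_deriv ?_
  have h := sol.vort_eq t ht x k
  simp only [curl_eq, strain_eq, pd_eq] at h
  rw [rhs]
  linarith

lemma enst_hasDeriv {ν : ℝ} {T : ℝ≥0∞} (hT : 0 < T) (sol : AdmissibleSolution ν T)
    {t : ℝ} (ht : t ∈ timeSet T) :
    HasDerivWithinAt (fun s => ∫ x : E3, ∑ k, (curlS (sol.u s) k x) ^ 2)
      (∫ x : E3, ∑ k, 2 * (curlS (sol.u t) k x * rhs ν (sol.u t) k x)) (timeSet T) t := by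
  obtain ⟨b, hb, htb⟩ := timeSet_gt ht
  set K := Set.Icc 0 b with hK
  have hKs : K ⊆ timeSet T := fun s hs => timeSet_mono hb hs.1 hs.2
  have hSB : ∀ i, SB K (fun t => sol.u t i) := by
    intro i k n
    obtain ⟨C, hC⟩ := sol.seminorm_bdd K isCompact_Icc hKs k n i
    exact ⟨C, fun t ht => (hC t ht).1⟩
  choose C hC0 hC using fun k => (SB.curlS hSB k).decay
  choose D hD0 hD using fun k => rhs_bdd ν hSB k
  set g : ℝ → E3 → ℝ := fun s x => ∑ k, (curlS (sol.u s) k x) ^ 2 with hg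
  set g' : ℝ → E3 → ℝ := fun s x => ∑ k, 2 * (curlS (sol.u s) k x * rhs ν (sol.u s) k x) with hg'
  have hd : ∀ x, ∀ s ∈ timeSet T, HasDerivWithinAt (fun s => g s x) (g' s x) (timeSet T) s := by
    intro x s hs
    refine HasDerivWithinAt.fun_sum fun k _ => ?_
    refine ((curl_hasDeriv hT sol k x hs).pow 2).congr_deriv ?_
    simp
    ring
  set M : E3 → ℝ := fun x => (∑ k, 2 * (C k * D k)) * (1 + ‖x‖) ^ (-4 : ℝ) with hM
  have hMi : Integrable M := by
    refine Integrable.const_mul (integrable_one_add_norm ?_) _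
    simp
    norm_num
  have hb' : ∀ x, ∀ s ∈ K, ‖g' s x‖ ≤ M x := by
    intro x s hs
    simp only [hg', hM, Finset.sum_mul]
    refine (norm_sum_le _ _).trans (Finset.sum_le_sum fun k _ => ?_)
    rw [norm_mul, norm_mul, Real.norm_eq_abs, Real.norm_eq_abs, Real.norm_eq_abs, abs_two]
    calc 2 * (|curlS (sol.u s) k x| * |rhs ν (sol.u s) k x|) ≤
        2 * (C k * (1 + ‖x‖) ^ (-4 : ℝ) * D k) := by
          have := mul_le_mul (hC k s hs x) (hD k s hs x) (abs_nonneg _)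
            (mul_nonneg (hC0 k) (by positivity))
          linarith
      _ = _ := by ring
  have htK : t ∈ K := ⟨ht.1, htb.le⟩
  have hlip : ∀ x, ∀ s ∈ K, ‖g s x - g t x‖ ≤ M x * ‖s - t‖ := by
    intro x s hs
    exact Convex.norm_image_sub_le_of_norm_hasDerivWithin_le (f := fun s => g s x)
      (f' := fun s => g' s x) (s := K)
      (fun r hr => (hd x r (hKs hr)).mono hKs) (hb' x) (convex_Icc 0 b) htK hs
  have hgi : ∀ s, Integrable (g s) := by
    intro s
    refine integrable_finsetSum _ fun k _ => ?_
    refine (mul_integrable (curlS (sol.u s) k) (curlS (sol.u s) k)).congr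
      (Filter.Eventually.of_forall fun x => ?_)
    simp only
    ring
  have hKn : ∀ᶠ s in nhdsWithin t (timeSet T \ {t}), s ∈ K := by
    have h1 : ∀ᶠ s in nhdsWithin t (timeSet T \ {t}), s < b :=
      mem_nhdsWithin_of_mem_nhds (Iio_mem_nhds htb)
    filter_upwards [h1, self_mem_nhdsWithin] with s hs hs2
    exact ⟨hs2.1.1, hs.le⟩
  rw [hasDerivWithinAt_iff_tendsto_slope]
  have hsl : ∀ s, slope (fun s => ∫ x : E3, g s x) t s = ∫ x : E3, slope (fun s => g s x) t s := by
    intro s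
    simp only [slope_def_field]
    rw [integral_div, integral_sub (hgi s) (hgi t)]
  have hsl' : slope (fun s => ∫ x : E3, g s x) t = fun s => ∫ x : E3, slope (fun s => g s x) t s :=
    funext hsl
  rw [hsl']
  apply tendsto_integral_filter_of_dominated_convergence M
  · refine Filter.Eventually.of_forall fun s => ?_
    simp only [slope_def_field]
    exact (((hgi s).sub (hgi t)).div_const _).aestronglyMeasurable
  · filter_upwards [hKn, self_mem_nhdsWithin] with s hs hs2
    refine Filter.Eventually.of_forall fun x => ?_
    have hne : s - t ≠ 0 := sub_ne_zero.mpr hs2.2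
    rw [slope_def_field, norm_div, div_le_iff₀ (norm_pos_iff.mpr hne)]
    exact hlip x s hs
  · exact hMi
  · refine Filter.Eventually.of_forall fun x => ?_
    exact hasDerivWithinAt_iff_tendsto_slope.mp (hd x t ht)

lemma R1_le : R₁ ≤ 2 := by
  have h : √3 * π ≤ 4 * √2 := by
    rw [← Real.sqrt_sq (show (0:ℝ) ≤ 4 by norm_num), ← Real.sqrt_sq pi_pos.le,
      ← Real.sqrt_mul (by norm_num), ← Real.sqrt_mul (by norm_num)]
    apply Real.sqrt_le_sqrt
    have h1 := Real.pi_lt_d2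
    have h2 := Real.pi_pos
    nlinarith
  unfold R₁
  have h2 : 0 < √2 := by positivity
  rw [div_mul_eq_mul_div, div_le_iff₀ (by positivity)]
  linarith

lemma R1_pos : 0 < R₁ := by
  unfold R₁; positivity

/-- For an admissible solution of the vorticity equation on `[0,T)` with viscosity
`ν > 0`, the function `t ↦ ‖ω(t,·)‖²_{L²}` is differentiable on `[0,T)` with
derivative at most `−(2/R₁)‖ω(t,·)‖²_{Ḣ¹}(R₁ν − ‖ω_h(t,·)‖_{Ḣ^{−1/2}})`. -/
theorem statement8 (ν : ℝ) (hν : 0 < ν) (T : ℝ≥0∞) (hT : 0 < T)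
    (sol : AdmissibleSolution ν T) :
    ∀ t ∈ timeSet T, ∃ d : ℝ,
      HasDerivWithinAt (fun s => ∫ x : E3, ∑ k, (sol.vort s k x) ^ 2) d (timeSet T) t ∧
      d ≤ -(2 / R₁) * hsV 1 (sol.vort t) *
        (R₁ * ν - Real.sqrt (hsV (-(1 / 2)) (sol.vorth t))) := by
  intro t ht
  have hv : ∀ s, sol.vort s = fun k => ⇑(curlS (sol.u s) k) := by
    intro s
    funext k
    exact curl_eq (sol.u s) k
  have h1 := enst_hasDeriv hT sol ht
  have h2 := energy ν (sol.u t) (sol.divfree t ht)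
  have h3 := stretch (sol.u t) (sol.divfree t ht) (sol.vorth t)
    (by simp [AdmissibleSolution.vorth, hv]) (by simp [AdmissibleSolution.vorth, hv])
    (by simp [AdmissibleSolution.vorth])
  refine ⟨∫ x : E3, ∑ k, 2 * (curlS (sol.u t) k x * rhs ν (sol.u t) k x), ?_, ?_⟩
  · simp only [hv]
    exact h1
  · rw [h2, hv]
    set H := hsV 1 (fun k => ⇑(curlS (sol.u t) k)) with hH
    set q := √(hsV (-(1 / 2)) (sol.vorth t)) with hq
    have hH0 : 0 ≤ H := by
      rw [hH]; unfold hsV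
      exact integral_nonneg fun ξ => by positivity
    have hq0 : 0 ≤ q := Real.sqrt_nonneg _
    have hR := R1_pos
    have hR2 : 1 ≤ 2 / R₁ := by
      rw [le_div_iff₀ hR]; linarith [R1_le]
    have e : -(2 / R₁) * H * (R₁ * ν - q) = -2 * ν * H + (2 / R₁) * (q * H) := by
      field_simp
      ring
    rw [e]
    have := mul_le_mul_of_nonneg_right hR2 (mul_nonneg hq0 hH0)
    linarith
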